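/- Let Ω ⊂ ℝⁿ be open and bounded and 1 < p < ∞. Assume f : Ω × ℝ × ℝⁿ → ℝ is uniformly continuous, non-increasing in its second variable s, and satisfies the growth condition |f(x,s,η)| ≤ γ(|s|)|η|^{p−1} + φ₀(x) with γ : [0,∞) → [0,∞) continuous and φ₀ ∈ L^∞_loc(Ω). Let u : Ω → ℝ be bounded, locally Lipschitz, and a viscosity supersolution of −Δ_p u = f(x,u,∇u) in Ω, and let u_ε be its infimal convolutions with exponent q, where q = 2 if p ≥ 2 and q > p/(p−1) if 1 < p < 2. Then the gradients ∇u_ε converge strongly to ∇u in L^p_loc(Ω): for every compact K ⊂ Ω, ∫_K |∇u_ε − ∇u|^p dx → 0 as ε → 0. -/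

import Mathlib

open MeasureTheory Metric Set Filter
open scoped RealInnerProductSpace ENNReal Topology NNReal

noncomputable section

abbrev Euc (n : ℕ) := EuclideanSpace ℝ (Fin n)

variable {n : ℕ}

/-- The p-Laplacian `Δ_p φ (x) = |∇φ|^{p-2} ( Δφ + (p-2)|∇φ|^{-2} ⟨D²φ ∇φ, ∇φ⟩ )` of a C² function
at a point where the gradient does not vanish (junk value elsewhere). -/
def pLap (p : ℝ) (φ : Euc n → ℝ) (x : Euc n) : ℝ :=
  ‖gradient φ x‖ ^ (p - 2) *
    ((LinearMap.trace ℝ (Euc n)) (fderiv ℝ (gradient φ) x).toLinearMap +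
      ((p - 2) / ‖gradient φ x‖ ^ (2 : ℕ)) *
        ⟪(fderiv ℝ (gradient φ) x) (gradient φ x), gradient φ x⟫)

/-- `lim_{r → 0} sup_{x ∈ B_r(x₀) \ {x₀}} g(x)`, as a monotone limit in the extended reals. -/
def limsupPunct (g : Euc n → ℝ) (x₀ : Euc n) : EReal :=
  ⨅ (r : ℝ) (_ : 0 < r), ⨆ x ∈ ball x₀ r \ {x₀}, (g x : EReal)

/-- Viscosity supersolution of `-Δ_p u = f(x, u, ∇u)` in an open set `Ω`. -/
def IsViscositySupersolution (p : ℝ) (f : Euc n → ℝ → Euc n → ℝ) (Ω : Set (Euc n))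
    (u : Euc n → ℝ) : Prop :=
  ∀ x₀ ∈ Ω, ∀ φ : Euc n → ℝ, ContDiffOn ℝ 2 φ Ω →
    φ x₀ = u x₀ → (∀ x ∈ Ω, φ x ≤ u x) → (∀ x ∈ Ω, x ≠ x₀ → gradient φ x ≠ 0) →
    (f x₀ (u x₀) (gradient φ x₀) : EReal) ≤ limsupPunct (fun x => -pLap p φ x) x₀

/-- Viscosity subsolution: `-u` is a viscosity supersolution of `-Δ_p v = -f(x, -v, -∇v)`. -/
def IsViscositySubsolution (p : ℝ) (f : Euc n → ℝ → Euc n → ℝ) (Ω : Set (Euc n))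
    (u : Euc n → ℝ) : Prop :=
  IsViscositySupersolution p (fun x s η => -(f x (-s) (-η))) Ω (fun x => -(u x))

def IsViscositySolution (p : ℝ) (f : Euc n → ℝ → Euc n → ℝ) (Ω : Set (Euc n))
    (u : Euc n → ℝ) : Prop :=
  IsViscositySupersolution p f Ω u ∧ IsViscositySubsolution p f Ω u

/-- Weak (distributional) supersolution of `-Δ_p u = f(x, u, ∇u)` in `Ω`, where `gradient u` is
the a.e.-defined pointwise gradient. -/
def IsWeakSupersolution (p : ℝ) (f : Euc n → ℝ → Euc n → ℝ) (Ω : Set (Euc n))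
    (u : Euc n → ℝ) : Prop :=
  ∀ ψ : Euc n → ℝ, ContDiff ℝ (⊤ : ℕ∞) ψ → HasCompactSupport ψ → tsupport ψ ⊆ Ω → (∀ x, 0 ≤ ψ x) →
    ∫ x in Ω, f x (u x) (gradient u x) * ψ x ≤
      ∫ x in Ω, ‖gradient u x‖ ^ (p - 2) * ⟪gradient u x, gradient ψ x⟫

def IsWeakSubsolution (p : ℝ) (f : Euc n → ℝ → Euc n → ℝ) (Ω : Set (Euc n))
    (u : Euc n → ℝ) : Prop :=
  IsWeakSupersolution p (fun x s η => -(f x (-s) (-η))) Ω (fun x => -(u x))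

def IsWeakSolution (p : ℝ) (f : Euc n → ℝ → Euc n → ℝ) (Ω : Set (Euc n))
    (u : Euc n → ℝ) : Prop :=
  IsWeakSupersolution p f Ω u ∧ IsWeakSubsolution p f Ω u

/-- `f` is non-increasing in its second argument. -/
def NonincreasingInS (f : Euc n → ℝ → Euc n → ℝ) : Prop :=
  ∀ x η, ∀ s₁ s₂ : ℝ, s₁ ≤ s₂ → f x s₂ η ≤ f x s₁ η

/-- `φ₀ ∈ L^∞_loc(Ω)`. -/
def LocEssBddOn (φ₀ : Euc n → ℝ) (Ω : Set (Euc n)) : Prop :=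
  ∀ x ∈ Ω, ∃ t ∈ 𝓝 x, ∃ C : ℝ, ∀ᵐ y ∂(volume : Measure (Euc n)), y ∈ t → |φ₀ y| ≤ C

/-- `f` is locally Lipschitz continuous with respect to its third variable `η`. -/
def LocLipschitzInEta (f : Euc n → ℝ → Euc n → ℝ) (Ω : Set (Euc n)) : Prop :=
  ∀ x ∈ Ω, ∀ s : ℝ, ∀ η₀ : Euc n, ∃ ε > 0, ∃ K : ℝ,
    ∀ η₁ ∈ ball η₀ ε, ∀ η₂ ∈ ball η₀ ε, |f x s η₁ - f x s η₂| ≤ K * ‖η₁ - η₂‖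

/-- The oscillation `sup_Ω u - inf_Ω u`. -/
def oscOn (u : Euc n → ℝ) (Ω : Set (Euc n)) : ℝ := sSup (u '' Ω) - sInf (u '' Ω)

/-- The infimal convolution `u_ε(x) = inf_{y ∈ Ω} ( u(y) + |x-y|^q / (q ε^{q-1}) )`. -/
def infConv (u : Euc n → ℝ) (Ω : Set (Euc n)) (q ε : ℝ) (x : Euc n) : ℝ :=
  ⨅ y : Ω, (u y + ‖x - (y : Euc n)‖ ^ q / (q * ε ^ (q - 1)))

/-- The radius `r(ε) = ( q ε^{q-1} ( osc_Ω u + 1 ) )^{1/q}`. -/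
def rEps (u : Euc n → ℝ) (Ω : Set (Euc n)) (q ε : ℝ) : ℝ :=
  (q * ε ^ (q - 1) * (oscOn u Ω + 1)) ^ (1 / q)

/-- `f_r(x, s, η) = inf_{y ∈ B_r(x)} f(y, s, η)`. -/
def fEps (f : Euc n → ℝ → Euc n → ℝ) (r : ℝ) (x : Euc n) (s : ℝ) (η : Euc n) : ℝ :=
  ⨅ y : ball x r, f (y : Euc n) s η

/-- Rescaling by `ε` turns the penalty of the infimal convolution into `ε * (‖·‖ ^ q / q)`. -/
lemma norm_rpow_div_eq_mul_norm_smul {q ε : ℝ} (hε : 0 < ε) (v : Euc n) :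
    ‖v‖ ^ q / (q * ε ^ (q - 1)) = ε * (‖ε⁻¹ • v‖ ^ q / q) := by
  rw [norm_smul, Real.norm_of_nonneg (inv_nonneg.2 hε.le),
    Real.mul_rpow (inv_nonneg.2 hε.le) (norm_nonneg v), Real.inv_rpow hε.le,
    Real.rpow_sub_one hε.ne']
  rcases eq_or_ne q 0 with rfl | hq
  · simp
  have := (Real.rpow_pos_of_pos hε q).ne'
  field_simp

lemma bddBelow_range_infConv {Ω : Set (Euc n)} {u : Euc n → ℝ} {C : ℝ}
    (hC : ∀ x ∈ Ω, |u x| ≤ C) {q ε : ℝ} (hq : 2 ≤ q) (hε : 0 < ε) (x : Euc n) :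
    BddBelow (range fun y : Ω => u y + ‖x - (y : Euc n)‖ ^ q / (q * ε ^ (q - 1))) := by
  refine ⟨-C, ?_⟩
  rintro _ ⟨y, rfl⟩
  have h1 := (abs_le.1 (hC y y.2)).1
  have h2 : 0 ≤ ‖x - (y : Euc n)‖ ^ q / (q * ε ^ (q - 1)) := by positivity
  dsimp only
  linarith

lemma infConv_le {Ω : Set (Euc n)} {u : Euc n → ℝ} {C : ℝ}
    (hC : ∀ x ∈ Ω, |u x| ≤ C) {q ε : ℝ} (hq : 2 ≤ q) (hε : 0 < ε) (x : Euc n) {y : Euc n}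
    (hy : y ∈ Ω) : infConv u Ω q ε x ≤ u y + ‖x - y‖ ^ q / (q * ε ^ (q - 1)) :=
  ciInf_le (bddBelow_range_infConv hC hq hε x) (⟨y, hy⟩ : Ω)

/-- The infimal convolution of a bounded function on a bounded set is Lipschitz on balls. -/
lemma exists_lipschitzOnWith_infConv {Ω : Set (Euc n)} (hΩb : Bornology.IsBounded Ω)
    (hΩ : Ω.Nonempty) {u : Euc n → ℝ} {C : ℝ} (hC : ∀ x ∈ Ω, |u x| ≤ C) {q ε : ℝ} (hq : 2 ≤ q)
    (hε : 0 < ε) (ρ : ℝ) : ∃ L, LipschitzOnWith L (infConv u Ω q ε) (ball 0 ρ) := by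
  obtain ⟨r, hr⟩ := hΩb.subset_closedBall 0
  obtain ⟨L, hL⟩ := LocallyLipschitzOn.exists_lipschitzOnWith_of_compact
    (isCompact_closedBall (0 : Euc n) (ρ + r))
    ((contDiff_norm_rpow (E := Euc n) (p := q) (by linarith)).locallyLipschitz.locallyLipschitzOn
      (s := closedBall 0 (ρ + r)))
  have hden : 0 < q * ε ^ (q - 1) := by positivity
  have hmem : ∀ x ∈ ball (0 : Euc n) ρ, ∀ y ∈ Ω, x - y ∈ closedBall (0 : Euc n) (ρ + r) := by
    intro x hx y hy
    have hy' := hr hy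
    simp only [mem_ball_zero_iff, mem_closedBall_zero_iff] at hx hy' ⊢
    linarith [norm_sub_le x y]
  have : Nonempty Ω := hΩ.to_subtype
  refine ⟨_, LipschitzOnWith.of_le_add_mul' (L / (q * ε ^ (q - 1))) fun x hx x' hx' => ?_⟩
  rw [← sub_le_iff_le_add]
  refine le_ciInf fun y => ?_
  have h1 := infConv_le hC hq hε x y.2
  have h2 := hL.dist_le_mul _ (hmem x hx y y.2) _ (hmem x' hx' y y.2)
  rw [dist_sub_right, Real.dist_eq] at h2
  have h3 : ‖x - (y : Euc n)‖ ^ q / (q * ε ^ (q - 1)) ≤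
      ‖x' - (y : Euc n)‖ ^ q / (q * ε ^ (q - 1)) + L / (q * ε ^ (q - 1)) * dist x x' := by
    rw [div_mul_eq_mul_div, ← add_div]
    gcongr
    linarith [le_abs_self (‖x - (y : Euc n)‖ ^ q - ‖x' - (y : Euc n)‖ ^ q)]
  linarith

/-- Rademacher's theorem for the infimal convolution of a bounded function on a bounded set. -/
lemma ae_differentiableAt_infConv {Ω : Set (Euc n)} (hΩb : Bornology.IsBounded Ω)
    {u : Euc n → ℝ} {C : ℝ} (hC : ∀ x ∈ Ω, |u x| ≤ C) {q ε : ℝ} (hq : 2 ≤ q) (hε : 0 < ε) :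
    ∀ᵐ x, x ∈ Ω → DifferentiableAt ℝ (infConv u Ω q ε) x := by
  rcases Ω.eq_empty_or_nonempty with rfl | hΩ
  · simp
  obtain ⟨r, hr⟩ := hΩb.subset_ball 0
  obtain ⟨L, hL⟩ := exists_lipschitzOnWith_infConv hΩb hΩ hC hq hε r
  filter_upwards [hL.ae_differentiableWithinAt_of_mem (μ := volume)] with x hx hxΩ
  exact (hx (hr hxΩ)).differentiableAt (isOpen_ball.mem_nhds (hr hxΩ))

/-- The gradient of the infimal convolution at `x`, expressed through a rescaled minimizer. -/
lemma gradient_infConv_eq {Ω : Set (Euc n)} {u : Euc n → ℝ} {C : ℝ}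
    (hC : ∀ x ∈ Ω, |u x| ≤ C) {q ε : ℝ} (hq : 2 ≤ q) (hε : 0 < ε) {x z : Euc n}
    (hz : x + ε • z ∈ Ω)
    (hmin : ∀ w, x + ε • w ∈ Ω →
      u (x + ε • z) + ε * (‖z‖ ^ q / q) ≤ u (x + ε • w) + ε * (‖w‖ ^ q / q))
    (hd : DifferentiableAt ℝ (infConv u Ω q ε) x) :
    gradient (infConv u Ω q ε) x = -(‖z‖ ^ (q - 2) • z) := by
  have hsub : ε⁻¹ • (x - (x + ε • z)) = -z := by
    rw [sub_add_cancel_left, smul_neg, inv_smul_smul₀ hε.ne']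
  have : Nonempty Ω := ⟨⟨_, hz⟩⟩
  have heq : u (x + ε • z) + ε * (‖z‖ ^ q / q) ≤ infConv u Ω q ε x := by
    refine le_ciInf fun y => ?_
    have hy : x + ε • (ε⁻¹ • ((y : Euc n) - x)) = y := by
      rw [smul_inv_smul₀ hε.ne', add_sub_cancel]
    have := hmin (ε⁻¹ • ((y : Euc n) - x)) (by rw [hy]; exact y.2)
    rwa [hy, ← norm_rpow_div_eq_mul_norm_smul hε, norm_sub_rev] at this
  have hloc : IsLocalMin (fun x' => ε * (‖ε⁻¹ • (x' - (x + ε • z))‖ ^ q / q) -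
      infConv u Ω q ε x') x := by
    refine Eventually.of_forall fun x' => ?_
    have := infConv_le hC hq hε x' hz
    rw [norm_rpow_div_eq_mul_norm_smul hε] at this
    simp only [hsub, norm_neg]
    linarith
  have hinner : HasFDerivAt (fun x' : Euc n => ε⁻¹ • (x' - (x + ε • z)))
      (ε⁻¹ • ContinuousLinearMap.id ℝ (Euc n)) x :=
    ((hasFDerivAt_id x).sub_const _).fun_const_smul _
  have hpen := (((hasFDerivAt_norm_rpow (ε⁻¹ • (x - (x + ε • z))) (p := q)
    (by linarith)).comp x hinner).mul_const q⁻¹).const_mul ε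
  have hzero := hloc.hasFDerivAt_eq_zero (hpen.sub hd.hasFDerivAt)
  rw [← toDual_gradient, sub_eq_zero] at hzero
  refine ext_inner_right ℝ fun w => ?_
  have hw := congrArg (fun T : Euc n →L[ℝ] ℝ => T w) hzero
  have hq0 : q ≠ 0 := by positivity
  simp only [hsub, InnerProductSpace.toDual_apply_apply] at hw
  rw [← hw]
  simp [inner_smul_left]
  field_simp

/-- Rescaled minimizers in the infimal convolution exist and are bounded by a constant depending
only on `q` and the Lipschitz constant. -/
lemma exists_rescaled_minimizer {Ω : Set (Euc n)} {u : Euc n → ℝ} (hu : ContinuousOn u Ω)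
    {q ε M : ℝ} (hq : 2 ≤ q) (hε : 0 < ε) {x : Euc n}
    (hM : ∀ y ∈ Ω, |u y - u x| ≤ M * ‖y - x‖)
    (hball : closedBall x (ε * max 1 (q * M)) ⊆ Ω) :
    ∃ z, ‖z‖ ≤ max 1 (q * M) ∧ x + ε • z ∈ Ω ∧ ∀ w, x + ε • w ∈ Ω →
      u (x + ε • z) + ε * (‖z‖ ^ q / q) ≤ u (x + ε • w) + ε * (‖w‖ ^ q / q) := by
  set R := max 1 (q * M)
  have hR1 : 1 ≤ R := le_max_left _ _
  have hq0 : 0 < q := by linarith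
  have hmaps : MapsTo (fun z : Euc n => x + ε • z) (closedBall 0 R) Ω := by
    intro z hz
    apply hball
    rw [mem_closedBall_zero_iff] at hz
    rw [mem_closedBall, dist_eq_norm, add_sub_cancel_left, norm_smul, Real.norm_of_nonneg hε.le]
    gcongr
  have hcont : ContinuousOn (fun z => u (x + ε • z) + ε * (‖z‖ ^ q / q)) (closedBall 0 R) := by
    refine (hu.comp (by fun_prop) hmaps).add (Continuous.continuousOn ?_)
    have : Continuous fun z : Euc n => ‖z‖ ^ q :=
      continuous_norm.rpow_const fun _ => Or.inr hq0.le
    fun_prop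
  have h0 : (0 : Euc n) ∈ closedBall (0 : Euc n) R := by simp; linarith
  obtain ⟨z, hz, hzmin⟩ := (isCompact_closedBall (0 : Euc n) R).exists_isMinOn ⟨0, h0⟩ hcont
  refine ⟨z, mem_closedBall_zero_iff.1 hz, hmaps hz, fun w hw => ?_⟩
  by_cases hwR : ‖w‖ ≤ R
  · exact hzmin (mem_closedBall_zero_iff.2 hwR)
  · push Not at hwR
    have hz0 := hzmin h0
    simp only [mem_ofPred_eq, smul_zero, add_zero, norm_zero, Real.zero_rpow hq0.ne', zero_div,
      mul_zero] at hz0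
    have hMw := hM _ hw
    rw [add_sub_cancel_left, norm_smul, Real.norm_of_nonneg hε.le] at hMw
    have hw1 : 1 ≤ ‖w‖ := hR1.trans hwR.le
    have hpow : q * M * ‖w‖ ≤ ‖w‖ ^ q :=
      calc q * M * ‖w‖ ≤ ‖w‖ * ‖w‖ := by
            gcongr
            exact (le_max_right _ _).trans hwR.le
        _ = ‖w‖ ^ (2 : ℝ) := by rw [Real.rpow_two, sq]
        _ ≤ ‖w‖ ^ q := Real.rpow_le_rpow_of_exponent_le hw1 hq
    have hdiv : M * ‖w‖ ≤ ‖w‖ ^ q / q := by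
      rw [le_div_iff₀ hq0]
      linarith
    have := mul_le_mul_of_nonneg_left hdiv hε.le
    linarith [(abs_le.1 hMw).1]

/-- Rescaled minimizers asymptotically satisfy the Euler-Lagrange equation of the limit problem
`min_z ⟪ξ, z⟫ + ‖z‖ ^ q / q`. -/
lemma tendsto_neg_norm_rpow_smul_of_minimizers {Ω : Set (Euc n)} {u : Euc n → ℝ} {x : Euc n}
    (hx : Ω ∈ 𝓝 x) (hd : DifferentiableAt ℝ u x) {q R : ℝ} (hq : 2 ≤ q) {ε : ℕ → ℝ}
    (hε : Tendsto ε atTop (𝓝[>] 0)) {z : ℕ → Euc n} (hzR : ∀ᶠ k in atTop, ‖z k‖ ≤ R)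
    (hmin : ∀ᶠ k in atTop, ∀ w, x + ε k • w ∈ Ω →
      u (x + ε k • z k) + ε k * (‖z k‖ ^ q / q) ≤ u (x + ε k • w) + ε k * (‖w‖ ^ q / q)) :
    Tendsto (fun k => -(‖z k‖ ^ (q - 2) • z k)) atTop (𝓝 (gradient u x)) := by
  have hq0 : 0 < q := by linarith
  refine tendsto_of_subseq_tendsto fun ns hns => ?_
  obtain ⟨z₀, -, φ, hφ, hz₀⟩ := (isCompact_closedBall (0 : Euc n) R).tendsto_subseq'
    (x := z ∘ ns) ((hns.eventually hzR).mono fun k hk => mem_closedBall_zero_iff.2 hk).frequently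
  refine ⟨φ, ?_⟩
  have hsub : Tendsto (ns ∘ φ) atTop atTop := hns.comp hφ.tendsto_atTop
  have hεφ := hε.comp hsub
  have hε0 := hεφ.mono_right nhdsWithin_le_nhds
  have hεpos : ∀ᶠ k in atTop, 0 < (ε ∘ ns ∘ φ) k := hεφ.eventually self_mem_nhdsWithin
  have hquot : ∀ (w : ℕ → Euc n) (w₀ : Euc n), Tendsto w atTop (𝓝 w₀) →
      Tendsto (fun k => ((ε ∘ ns ∘ φ) k)⁻¹ • (u (x + (ε ∘ ns ∘ φ) k • w k) - u x) + ‖w k‖ ^ q / q)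
        atTop (𝓝 (⟪gradient u x, w₀⟫ + ‖w₀‖ ^ q / q)) := by
    intro w w₀ hw
    refine Tendsto.add ?_ ((hw.norm.rpow_const (Or.inr hq0.le)).div_const q)
    have hlim := hd.hasGradientAt.hasFDerivAt.hasFDerivWithinAt (s := univ) |>.lim
      (l := atTop) (c := fun k => ((ε ∘ ns ∘ φ) k)⁻¹) (d := fun k => (ε ∘ ns ∘ φ) k • w k)
      (v := w₀) (by simpa using hε0.smul hw) (.of_forall fun _ => mem_univ _) (by
        refine hw.congr' ?_
        filter_upwards [hεpos] with k hk
        rw [inv_smul_smul₀ hk.ne'])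
    simpa using hlim
  have hz₀min : ∀ w, ⟪gradient u x, z₀⟫ + ‖z₀‖ ^ q / q ≤ ⟪gradient u x, w⟫ + ‖w‖ ^ q / q := by
    intro w
    refine le_of_tendsto_of_tendsto (hquot _ _ hz₀) (hquot _ _ tendsto_const_nhds) ?_
    have hwΩ : ∀ᶠ k in atTop, x + (ε ∘ ns ∘ φ) k • w ∈ Ω := by
      have : Tendsto (fun k => x + (ε ∘ ns ∘ φ) k • w) atTop (𝓝 x) := by
        simpa using (hε0.smul_const w).const_add x
      exact this.eventually hx
    filter_upwards [hεpos, hwΩ, hsub.eventually hmin] with k hk hkw hkmin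
    have := mul_le_mul_of_nonneg_left (hkmin w hkw) (inv_pos.2 hk).le
    simp only [Function.comp_apply, smul_eq_mul] at hk this ⊢
    rw [mul_add, mul_add, inv_mul_cancel_left₀ hk.ne', inv_mul_cancel_left₀ hk.ne'] at this
    linarith
  have heuler : -(‖z₀‖ ^ (q - 2) • z₀) = gradient u x := by
    have hloc : IsLocalMin (fun w => ⟪gradient u x, w⟫ + ‖w‖ ^ q * q⁻¹) z₀ :=
      .of_forall fun w => by simpa only [div_eq_mul_inv] using hz₀min w
    have hder := ((innerSL ℝ (gradient u x)).hasFDerivAt (x := z₀)).add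
      ((hasFDerivAt_norm_rpow z₀ (p := q) (by linarith)).mul_const q⁻¹)
    have hzero := hloc.hasFDerivAt_eq_zero hder
    refine ext_inner_right ℝ fun w => ?_
    have hw := congrArg (fun T : Euc n →L[ℝ] ℝ => T w) hzero
    simp [inner_smul_left] at hw ⊢
    field_simp at hw
    linarith
  rw [← heuler]
  exact ((hz₀.norm.rpow_const (Or.inr (by linarith))).smul hz₀).neg

/-- A bounded, locally Lipschitz function on an open set is Lipschitz at the points of a compact
subset, uniformly with respect to all points of the open set. -/
lemma exists_abs_sub_le_mul_norm_sub {Ω : Set (Euc n)} {u : Euc n → ℝ} {C : ℝ}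
    (hC : ∀ x ∈ Ω, |u x| ≤ C) (huLip : LocallyLipschitzOn Ω u) {K : Set (Euc n)}
    (hK : IsCompact K) {δ : ℝ} (hδ : 0 < δ) (hδΩ : cthickening δ K ⊆ Ω) :
    ∃ M, 0 ≤ M ∧ ∀ x ∈ K, ∀ y ∈ Ω, |u y - u x| ≤ M * ‖y - x‖ := by
  obtain ⟨L, hL⟩ := (huLip.mono hδΩ).exists_lipschitzOnWith_of_compact hK.cthickening
  refine ⟨max L (2 * C / δ), le_max_of_le_left L.2, fun x hx y hy => ?_⟩
  have hxK : x ∈ cthickening δ K := self_subset_cthickening K hx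
  by_cases hyK : ‖y - x‖ ≤ δ
  · have := hL.dist_le_mul y (mem_cthickening_of_dist_le y x δ K hx (by rwa [dist_eq_norm])) x hxK
    rw [Real.dist_eq, dist_eq_norm] at this
    exact this.trans (by gcongr; exact le_max_left _ _)
  · push Not at hyK
    have h1 := hC y hy
    have h2 := hC x (hδΩ hxK)
    have hC0 : 0 ≤ C := (abs_nonneg _).trans h1
    calc |u y - u x| ≤ |u y| + |u x| := abs_sub _ _
      _ ≤ 2 * C / δ * δ := by
        rw [div_mul_cancel₀ _ hδ.ne']
        linarith
      _ ≤ max (L : ℝ) (2 * C / δ) * ‖y - x‖ := by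
        gcongr
        exact le_max_right _ _

/-- Rademacher's theorem for locally Lipschitz functions, on compact subsets. -/
lemma LocallyLipschitzOn.ae_differentiableAt_of_mem_compact {Ω : Set (Euc n)} {u : Euc n → ℝ}
    (huLip : LocallyLipschitzOn Ω u) {K : Set (Euc n)} (hK : IsCompact K) {δ : ℝ} (hδ : 0 < δ)
    (hδΩ : cthickening δ K ⊆ Ω) : ∀ᵐ x, x ∈ K → DifferentiableAt ℝ u x := by
  obtain ⟨L, hL⟩ := (huLip.mono hδΩ).exists_lipschitzOnWith_of_compact hK.cthickening
  filter_upwards [hL.ae_differentiableWithinAt_of_mem (μ := volume)] with x hx hxK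
  exact (hx (self_subset_cthickening K hxK)).differentiableAt
    (mem_of_superset (isOpen_thickening.mem_nhds (self_subset_thickening hδ K hxK))
      (thickening_subset_cthickening δ K))

lemma measurable_gradient (v : Euc n → ℝ) : Measurable (gradient v) :=
  (InnerProductSpace.toDual ℝ (Euc n)).symm.continuous.measurable.comp (measurable_fderiv ℝ v)

/-- **Strong `L^p_loc` convergence of the gradients of the infimal convolutions** of a bounded,
locally Lipschitz viscosity supersolution `u`, with `q = 2` if `p ≥ 2` and `q > p/(p-1)` if
`1 < p < 2`. -/
theorem strong_convergence_of_gradients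
    (n : ℕ) (Ω : Set (Euc n)) (hΩo : IsOpen Ω) (hΩb : Bornology.IsBounded Ω)
    (p : ℝ) (hp : 1 < p)
    (f : Euc n → ℝ → Euc n → ℝ)
    (hfuc : UniformContinuousOn (fun w : Euc n × ℝ × Euc n => f w.1 w.2.1 w.2.2)
      (Ω ×ˢ (univ : Set ℝ) ×ˢ (univ : Set (Euc n))))
    (hfmono : NonincreasingInS f)
    (γ : ℝ → ℝ) (hγc : ContinuousOn γ (Ici 0)) (hγnn : ∀ t ∈ Ici (0 : ℝ), 0 ≤ γ t)
    (φ₀ : Euc n → ℝ) (hφ₀ : LocEssBddOn φ₀ Ω)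
    (hgrowth : ∀ x ∈ Ω, ∀ (s : ℝ) (η : Euc n), |f x s η| ≤ γ |s| * ‖η‖ ^ (p - 1) + φ₀ x)
    (u : Euc n → ℝ) (hubdd : ∃ C, ∀ x ∈ Ω, |u x| ≤ C) (huLip : LocallyLipschitzOn Ω u)
    (hvisc : IsViscositySupersolution p f Ω u)
    (q : ℝ) (hq1 : 2 ≤ p → q = 2) (hq2 : p < 2 → p / (p - 1) < q)
    (K : Set (Euc n)) (hK : IsCompact K) (hKΩ : K ⊆ Ω) :
    Tendsto (fun ε => ∫ x in K, ‖gradient (infConv u Ω q ε) x - gradient u x‖ ^ p)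
      (𝓝[>] (0 : ℝ)) (𝓝 0) := by
  obtain ⟨C, hC⟩ := hubdd
  have hq : 2 ≤ q := by
    rcases le_or_gt 2 p with h | h
    · exact (hq1 h).ge
    · refine le_trans ?_ (hq2 h).le
      rw [le_div_iff₀ (by linarith)]
      linarith
  obtain ⟨δ, hδ, hδΩ⟩ := hK.exists_cthickening_subset_open hΩo hKΩ
  obtain ⟨M, hM0, hM⟩ := exists_abs_sub_le_mul_norm_sub hC huLip hK hδ hδΩ
  set R := max 1 (q * M)
  have hR1 : 1 ≤ R := le_max_left _ _
  refine tendsto_of_seq_tendsto fun ε hε => ?_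
  have hεpos : ∀ᶠ k in atTop, 0 < ε k := hε.eventually self_mem_nhdsWithin
  have hεR : ∀ᶠ k in atTop, ε k * R ≤ δ := by
    have : Tendsto (fun k => ε k * R) atTop (𝓝 0) := by
      simpa using (hε.mono_right nhdsWithin_le_nhds).mul_const R
    exact this.eventually_le_const hδ
  have hzmin : ∀ x ∈ K, ∀ k, 0 < ε k → ε k * R ≤ δ →
      ∃ z, ‖z‖ ≤ R ∧ x + ε k • z ∈ Ω ∧ ∀ w, x + ε k • w ∈ Ω →
        u (x + ε k • z) + ε k * (‖z‖ ^ q / q) ≤ u (x + ε k • w) + ε k * (‖w‖ ^ q / q) :=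
    fun x hx k hk hkR => exists_rescaled_minimizer huLip.continuousOn hq hk (hM x hx)
      ((closedBall_subset_closedBall hkR).trans
        ((closedBall_subset_cthickening hx δ).trans hδΩ))
  have hdu := huLip.ae_differentiableAt_of_mem_compact hK hδ hδΩ
  have hduε : ∀ᵐ x, ∀ k, 0 < ε k → x ∈ Ω → DifferentiableAt ℝ (infConv u Ω q (ε k)) x :=
    ae_all_iff.2 fun k => by
      by_cases hk : 0 < ε k
      · simpa [hk] using ae_differentiableAt_infConv hΩb hC hq hk
      · simp [hk]
  have hlim := tendsto_integral_filter_of_dominated_convergence (l := atTop)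
    (μ := volume.restrict K) (f := fun _ => (0 : ℝ))
    (F := fun k x => ‖gradient (infConv u Ω q (ε k)) x - gradient u x‖ ^ p)
    (fun _ => (R ^ (q - 1) + M) ^ p) ?_ ?_ ?_ ?_
  · simpa [Function.comp_def] using hlim
  · exact .of_forall fun k => (((measurable_gradient _).sub
      (measurable_gradient _)).norm.pow_const p).aestronglyMeasurable
  · filter_upwards [hεpos, hεR] with k hk hkR
    rw [ae_restrict_iff' hK.measurableSet]
    filter_upwards [hdu, hduε] with x hx hxε hxK
    obtain ⟨z, hzR, hzΩ, hz⟩ := hzmin x hxK k hk hkR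
    rw [Real.norm_of_nonneg (by positivity)]
    refine Real.rpow_le_rpow (norm_nonneg _) ((norm_sub_le _ _).trans (add_le_add ?_ ?_))
      (by linarith)
    · rw [gradient_infConv_eq hC hq hk hzΩ hz (hxε k hk (hKΩ hxK)), norm_neg, norm_smul,
        Real.norm_of_nonneg (by positivity)]
      calc ‖z‖ ^ (q - 2) * ‖z‖ ≤ R ^ (q - 2) * R := by
            gcongr
        _ = R ^ (q - 1) := by
            rw [← Real.rpow_add_one (by positivity)]
            ring_nf
    · rw [← LinearIsometryEquiv.norm_map (InnerProductSpace.toDual ℝ (Euc n)), toDual_gradient]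
      refine (hx hxK).hasFDerivAt.le_of_lip' hM0 ?_
      filter_upwards [hΩo.mem_nhds (hKΩ hxK)] with y hy using hM x hxK y hy
  · have : IsFiniteMeasure (volume.restrict K) := isFiniteMeasure_restrict.2 hK.measure_lt_top.ne
    exact integrable_const _
  · rw [ae_restrict_iff' hK.measurableSet]
    filter_upwards [hdu, hduε] with x hx hxε hxK
    choose! z hzR hzΩ hz using hzmin x hxK
    have hgood := hεpos.and hεR
    have hconv := tendsto_neg_norm_rpow_smul_of_minimizers (hΩo.mem_nhds (hKΩ hxK)) (hx hxK) hq hε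
      (hgood.mono fun k hk => hzR k hk.1 hk.2) (hgood.mono fun k hk => hz k hk.1 hk.2)
    have hgrad : Tendsto (fun k => gradient (infConv u Ω q (ε k)) x) atTop
        (𝓝 (gradient u x)) := by
      refine hconv.congr' (hgood.mono fun k hk => ?_)
      exact (gradient_infConv_eq hC hq hk.1 (hzΩ k hk.1 hk.2) (hz k hk.1 hk.2)
        (hxε k hk.1 (hKΩ hxK))).symm
    have := ((hgrad.sub_const (gradient u x)).norm).rpow_const (p := p) (Or.inr (by linarith))
    simpa [Real.zero_rpow (by linarith : p ≠ 0)] using this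

end
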